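/- arXiv:2312.07055 — 4 statements merged into one kernel-verified Lean document; each statement's English description precedes it below -/
import Mathlib

section
/- Let p be a prime number, let m be a positive integer with m ≤ p, and let a ∈ {1, …, p−1}, b ∈ {0, …, p−1}. Define the linear congruence hash h(x) = ((a·x + b) mod p) mod m. Then for every k ∈ {0, …, m−1}, the number of keys x ∈ {0, …, p−1} with h(x) = k is either ⌊p/m⌋ or ⌈p/m⌉; i.e. ⌊p/m⌋ ≤ |{x ∈ {0,…,p−1} : h(x) = k}| ≤ ⌈p/m⌉. -/
/-- An affine map with slope coprime to `p` permutes the residues modulo `p`. -/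
theorem image_affine_mod_range {p a : ℕ} (b : ℕ) (hp : 0 < p) (ha : p.Coprime a) :
    (Finset.range p).image (fun x => (a * x + b) % p) = Finset.range p := by
  refine Finset.eq_of_subset_of_card_le ?_ (Finset.card_image_of_injOn ?_).ge
  · simp only [Finset.image_subset_iff, Finset.mem_range]
    exact fun x _ => Nat.mod_lt _ hp
  · intro x hx y hy hxy
    have h : a * x + b ≡ a * y + b [MOD p] := hxy
    exact (Nat.ModEq.cancel_left_of_coprime ha h.add_right_cancel').eq_of_lt_of_lt
      (Finset.mem_range.mp hx) (Finset.mem_range.mp hy)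

theorem card_filter_affine_mod {p a : ℕ} (b : ℕ) (hp : 0 < p) (ha : p.Coprime a)
    (q : ℕ → Prop) [DecidablePred q] :
    ((Finset.range p).filter fun x => q ((a * x + b) % p)).card =
      ((Finset.range p).filter q).card := by
  have himage := image_affine_mod_range b hp ha
  have hinj : Set.InjOn (fun x => (a * x + b) % p) (Finset.range p) :=
    Finset.card_image_iff.mp (congrArg Finset.card himage)
  conv_rhs => rw [← himage, Finset.filter_image]
  exact (Finset.card_image_of_injOn (hinj.mono (Finset.filter_subset _ _))).symm

theorem card_filter_range_mod_eq (n : ℕ) {m k : ℕ} (hk : k < m) :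
    ((Finset.range n).filter fun x => x % m = k).card =
      n / m + if k < n % m then 1 else 0 := by
  have h := Nat.count_modEq_card n (Nat.zero_lt_of_lt hk) k
  rw [Nat.count_eq_card_filter_range] at h
  simpa only [Nat.ModEq, Nat.mod_eq_of_lt hk] using h


/-- each bin of the linear congruence hash
`h(x) = ((a·x + b) mod p) mod m` on the key space `{0, …, p−1}` receives
either `⌊p/m⌋` or `⌈p/m⌉` keys. -/
theorem linear_congruence_hash_balanced (p m a b k : ℕ) (hp : p.Prime)
    (hm : 0 < m) (hmp : m ≤ p) (ha : 1 ≤ a) (hap : a < p) (hb : b < p)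
    (hk : k < m) :
    p / m ≤ ((Finset.range p).filter fun x => ((a * x + b) % p) % m = k).card ∧
    ((Finset.range p).filter fun x => ((a * x + b) % p) % m = k).card
      ≤ (p + m - 1) / m := by
  have hcop : p.Coprime a := Nat.coprime_of_lt_prime (by omega) hap hp
  rw [card_filter_affine_mod b hp.pos hcop (fun y => y % m = k), card_filter_range_mod_eq p hk]
  refine ⟨Nat.le_add_right _ _, ?_⟩
  rw [Nat.le_div_iff_mul_le hm, add_mul, mul_comm (p / m)]
  have hdiv := Nat.div_add_mod p m
  split_ifs <;> omega
end

section
/- Let s and n be positive integers and set m = ⌈n/s⌉. Define the block-sampling map 𝒮 taking a bit vector a = (a_1, …, a_n) ∈ {0,1}^n to a random vector (a'_1, …, a'_m) ∈ {0,1}^m whose coordinates are independent and such that: for 1 ≤ i < m, a'_i equals a_j with probability 1/s for each j in the i-th block {(i−1)s+1, …, is}; and a'_m equals a_j with probability 1/s for each j in the final block {(m−1)s+1, …, n} and equals 0 with the remaining probability (ms − n)/s. Let Ω be a (finite or measurable) output space and let M : {0,1}^m → PMF(Ω) be a randomized map such that for all u, v ∈ {0,1}^m with Hamming distance at most 1 and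 every event S ⊆ Ω, e^{−ε′}·Pr[M(v) ∈ S] ≤ Pr[M(u) ∈ S] ≤ e^{ε′}·Pr[M(v) ∈ S]. Then for all a, â ∈ {0,1}^n with Hamming distance at most 1 and every event S ⊆ Ω, e^{−ε_s}·Pr[M(𝒮(â)) ∈ S] ≤ Pr[M(𝒮(a)) ∈ S] ≤ e^{ε_s}·Pr[M(𝒮(â)) ∈ S], where ε_s = ln(1 + (e^{ε′} − 1)/s). -/
open scoped ENNReal

/-- The block-sampling map `𝒮`: the `n` input bits are split into `m = ⌈n/s⌉`
blocks of `s` consecutive positions (the last block padded with `0`s), and for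
each block one position is chosen uniformly and independently at random; the
output is the vector of the `m` sampled bits. -/
noncomputable def blockSample (n m s : ℕ) (hs : 0 < s) (a : Fin n → Bool) :
    PMF (Fin m → Bool) :=
  haveI : Nonempty (Fin s) := ⟨⟨0, hs⟩⟩
  (PMF.uniformOfFintype (Fin m → Fin s)).map fun c i =>
    if h : i.val * s + (c i).val < n then a ⟨i.val * s + (c i).val, h⟩ else false

/-- Two functions differing only at `k`, the first of which is at `k` within a factor `E` of every
value of the second, have sums within the factor `1 + (E - 1) / |β|`. -/
theorem sum_le_of_eq_off_point {β : Type*} [Fintype β] (g h : β → ℝ) (k : β) {E : ℝ}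
    (hE : 1 ≤ E) (hgh : ∀ t, t ≠ k → g t = h t) (hk : ∀ t, g k ≤ E * h t) :
    ∑ t, g t ≤ (1 + (E - 1) / Fintype.card β) * ∑ t, h t := by
  classical
  have : Nonempty β := ⟨k⟩
  obtain ⟨t₀, ht₀⟩ := Finite.exists_min h
  have hcard : (0 : ℝ) < Fintype.card β := by exact_mod_cast Fintype.card_pos
  have havg : Fintype.card β * h t₀ ≤ ∑ t, h t := by
    simpa using Finset.card_nsmul_le_sum Finset.univ h (h t₀) fun t _ => ht₀ t
  have hdiff : ∑ t, g t - ∑ t, h t = g k - h k := by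
    rw [← Finset.sum_sub_distrib]
    exact Finset.sum_eq_single k (fun t _ ht => sub_eq_zero.2 (hgh t ht)) (by simp)
  have hmin : (E - 1) * h t₀ ≤ (E - 1) / Fintype.card β * ∑ t, h t := by
    rw [div_mul_eq_mul_div, le_div_iff₀ hcard, mul_assoc, mul_comm (h t₀)]
    exact mul_le_mul_of_nonneg_left havg (by linarith)
  linarith [hk t₀, ht₀ k]

/-- Version of `sum_le_of_eq_off_point` for sums over a product, where the coordinate `i` plays the
role of the variable and the others are parameters. -/
theorem sum_pi_le_of_eq_off_coord {ι β : Type*} [Fintype ι] [DecidableEq ι] [Fintype β]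
    (g h : (ι → β) → ℝ) (i : ι) (k : β) {E : ℝ} (hE : 1 ≤ E)
    (hgh : ∀ c, c i ≠ k → g c = h c)
    (hk : ∀ c d, (∀ j, j ≠ i → c j = d j) → g c ≤ E * h d) :
    ∑ c, g c ≤ (1 + (E - 1) / Fintype.card β) * ∑ c, h c := by
  rw [← (Equiv.funSplitAt i β).symm.sum_comp g, ← (Equiv.funSplitAt i β).symm.sum_comp h,
    Fintype.sum_prod_type_right, Fintype.sum_prod_type_right, Finset.mul_sum]
  refine Finset.sum_le_sum fun d _ => sum_le_of_eq_off_point _ _ k hE ?_ ?_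
  · intro t ht
    exact hgh _ (by simpa [Equiv.funSplitAt, Equiv.piSplitAt] using ht)
  · intro t
    refine hk _ _ fun j hj => ?_
    simp [Equiv.funSplitAt, Equiv.piSplitAt, hj]

theorem hammingDist_le_one_of_eq_off {ι : Type*} [Fintype ι] {β : ι → Type*}
    [∀ i, DecidableEq (β i)] {u v : ∀ i, β i} (i : ι) (h : ∀ j, j ≠ i → u j = v j) :
    hammingDist u v ≤ 1 := by
  refine (Finset.card_le_card fun j hj => ?_).trans (Finset.card_singleton i).le
  by_contra hji
  exact (Finset.mem_filter.1 hj).2 (h j (by simpa using hji))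

theorem exists_eq_off_of_hammingDist_le_one {ι : Type*} [Fintype ι] [Nonempty ι] {β : ι → Type*}
    [∀ i, DecidableEq (β i)] {u v : ∀ i, β i} (h : hammingDist u v ≤ 1) :
    ∃ i, ∀ j, j ≠ i → u j = v j := by
  obtain ⟨i, hi⟩ := Finset.card_le_one_iff_subset_singleton.1 h
  refine ⟨i, fun j hj => ?_⟩
  by_contra hne
  exact hj (Finset.mem_singleton.1 (hi (Finset.mem_filter.2 ⟨Finset.mem_univ j, hne⟩)))

/-- The vector of bits of `a` read at offset `c i` of block `i`, with `false` as padding. -/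
def selectBits {n m s : ℕ} (a : Fin n → Bool) (c : Fin m → Fin s) : Fin m → Bool := fun i =>
  if h : i.val * s + (c i).val < n then a ⟨i.val * s + (c i).val, h⟩ else false

theorem selectBits_congr {n m s : ℕ} {a b : Fin n → Bool} {j : Fin n}
    (hab : ∀ l, l ≠ j → a l = b l) {c d : Fin m → Fin s} {i : Fin m} (hcd : c i = d i)
    (hi : i.val * s + (c i).val ≠ j) : selectBits a c i = selectBits b d i := by
  unfold selectBits
  rw [← hcd]
  split_ifs with h
  · exact hab _ fun hj => hi (congrArg Fin.val hj)
  · rfl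

theorem toOuterMeasure_blockSample_bind {n m s : ℕ} (hs : 0 < s) {Ω : Type*}
    (M : (Fin m → Bool) → PMF Ω) (a : Fin n → Bool) (S : Set Ω) :
    ((blockSample n m s hs a).bind M).toOuterMeasure S =
      (Fintype.card (Fin m → Fin s) : ℝ≥0∞)⁻¹ *
        ∑ c : Fin m → Fin s, (M (selectBits a c)).toOuterMeasure S := by
  have : Nonempty (Fin s) := ⟨⟨0, hs⟩⟩
  rw [blockSample, PMF.bind_map, PMF.toOuterMeasure_bind_apply, tsum_fintype, Finset.mul_sum]
  refine Finset.sum_congr rfl fun c _ => ?_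
  rw [PMF.uniformOfFintype_apply]
  rfl

theorem toOuterMeasure_ne_top {α : Type*} (p : PMF α) (S : Set α) : p.toOuterMeasure S ≠ ⊤ :=
  ne_top_of_le_ne_top ENNReal.one_ne_top <|
    (MeasureTheory.measure_mono (Set.subset_univ S)).trans
      ((p.toOuterMeasure_apply_eq_one_iff Set.univ).2 (Set.subset_univ _)).le

theorem blockSample_bind_le {n m s : ℕ} (hn : 0 < n) (hs : 0 < s) (hm : m = (n + s - 1) / s)
    {Ω : Type*} {E : ℝ} (hE : 1 ≤ E) (M : (Fin m → Bool) → PMF Ω) (S : Set Ω)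
    (hM : ∀ u v : Fin m → Bool, hammingDist u v ≤ 1 →
      (M u).toOuterMeasure S ≤ ENNReal.ofReal E * (M v).toOuterMeasure S)
    (a b : Fin n → Bool) (hab : hammingDist a b ≤ 1) :
    ((blockSample n m s hs a).bind M).toOuterMeasure S ≤
      ENNReal.ofReal (1 + (E - 1) / s) * ((blockSample n m s hs b).bind M).toOuterMeasure S := by
  have : Nonempty (Fin n) := ⟨⟨0, hn⟩⟩
  obtain ⟨j, hj⟩ := exists_eq_off_of_hammingDist_le_one hab
  have hjm : j.val / s < m := by
    have hle : (j.val + s) / s ≤ (n + s - 1) / s := Nat.div_le_div_right (by omega)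
    rw [Nat.add_div_right _ hs] at hle
    omega
  have hfin : ∀ u, (M u).toOuterMeasure S ≠ ⊤ := fun u => toOuterMeasure_ne_top _ _
  set f : (Fin m → Bool) → ℝ := fun u => ((M u).toOuterMeasure S).toReal
  have hf : ∀ u, (M u).toOuterMeasure S = ENNReal.ofReal (f u) := fun u =>
    (ENNReal.ofReal_toReal (hfin u)).symm
  have hf0 : ∀ u, 0 ≤ f u := fun u => ENNReal.toReal_nonneg
  have hfE : ∀ u v, hammingDist u v ≤ 1 → f u ≤ E * f v := by
    intro u v huv
    have h := hM u v huv
    rw [hf, hf, ← ENNReal.ofReal_mul (by linarith)] at h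
    exact (ENNReal.ofReal_le_ofReal_iff (mul_nonneg (by linarith) (hf0 v))).1 h
  have hdiv : ∀ (i : Fin m) (t : Fin s), i.val * s + t.val = j → i.val = j.val / s ∧
      t.val = j.val % s := by
    intro i t h
    rw [← h, mul_comm, Nat.mul_add_div hs, Nat.mul_add_mod, Nat.div_eq_of_lt t.2,
      Nat.mod_eq_of_lt t.2]
    simp
  have key : ∑ c : Fin m → Fin s, f (selectBits a c) ≤
      (1 + (E - 1) / s) * ∑ c : Fin m → Fin s, f (selectBits b c) := by
    have h := sum_pi_le_of_eq_off_coord (fun c : Fin m → Fin s => f (selectBits a c))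
      (fun c => f (selectBits b c)) ⟨j.val / s, hjm⟩ ⟨j.val % s, Nat.mod_lt _ hs⟩ hE ?_ ?_
    · simpa using h
    · intro c hc
      refine congrArg f (funext fun i => selectBits_congr hj rfl fun h => hc ?_)
      obtain ⟨hi, ht⟩ := hdiv _ _ h
      obtain rfl : i = ⟨j.val / s, hjm⟩ := Fin.ext hi
      exact Fin.ext ht
    · intro c d hcd
      refine hfE _ _ (hammingDist_le_one_of_eq_off ⟨j.val / s, hjm⟩ fun i hi => ?_)
      exact selectBits_congr hj (hcd i hi) fun h => hi (Fin.ext (hdiv _ _ h).1)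
  have hK : 0 ≤ 1 + (E - 1) / s := by
    have : 0 ≤ (E - 1) / s := div_nonneg (by linarith) (Nat.cast_nonneg s)
    linarith
  rw [toOuterMeasure_blockSample_bind, toOuterMeasure_blockSample_bind, mul_left_comm]
  gcongr
  simp only [hf]
  rw [← ENNReal.ofReal_sum_of_nonneg fun _ _ => hf0 _,
    ← ENNReal.ofReal_sum_of_nonneg fun _ _ => hf0 _, ← ENNReal.ofReal_mul hK]
  exact ENNReal.ofReal_le_ofReal key

/-- amplification by sub-sampling.  If `M` satisfies an
`ε′`-ratio bound for inputs at Hamming distance at most 1, then `M ∘ 𝒮`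
satisfies the `ε_s`-ratio bound with `ε_s = ln(1 + (e^{ε′} − 1)/s)`. -/
theorem amplification_by_subsampling {n m s : ℕ} (hn : 0 < n) (hs : 0 < s)
    (hm : m = (n + s - 1) / s) {Ω : Type*} (ε' : ℝ)
    (M : (Fin m → Bool) → PMF Ω)
    (hM : ∀ u v : Fin m → Bool, hammingDist u v ≤ 1 → ∀ S : Set Ω,
      ENNReal.ofReal (Real.exp (-ε')) * (M v).toOuterMeasure S
          ≤ (M u).toOuterMeasure S ∧
      (M u).toOuterMeasure S
          ≤ ENNReal.ofReal (Real.exp ε') * (M v).toOuterMeasure S) :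
    ∀ a ahat : Fin n → Bool, hammingDist a ahat ≤ 1 → ∀ S : Set Ω,
      ENNReal.ofReal (Real.exp (-(Real.log (1 + (Real.exp ε' - 1) / s))))
            * ((blockSample n m s hs ahat).bind M).toOuterMeasure S
          ≤ ((blockSample n m s hs a).bind M).toOuterMeasure S ∧
      ((blockSample n m s hs a).bind M).toOuterMeasure S
          ≤ ENNReal.ofReal (Real.exp (Real.log (1 + (Real.exp ε' - 1) / s)))
            * ((blockSample n m s hs ahat).bind M).toOuterMeasure S := by
  intro a ahat hd S
  have hE : 1 ≤ Real.exp ε' := by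
    have h := (hM (fun _ => false) (fun _ => false) (by simp) Set.univ).2
    rw [((M _).toOuterMeasure_apply_eq_one_iff Set.univ).2 (Set.subset_univ _), mul_one] at h
    exact ENNReal.one_le_ofReal.1 h
  have hK : 0 < 1 + (Real.exp ε' - 1) / s := by
    have : 0 ≤ (Real.exp ε' - 1) / s := div_nonneg (by linarith) (Nat.cast_nonneg s)
    linarith
  have upper := blockSample_bind_le hn hs hm hE M S fun u v huv => (hM u v huv S).2
  rw [Real.exp_neg, Real.exp_log hK]
  refine ⟨?_, upper a ahat hd⟩
  rw [ENNReal.ofReal_inv_of_pos hK, mul_comm, ← div_eq_mul_inv]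
  exact ENNReal.div_le_of_le_mul' (upper ahat a (by rwa [hammingDist_comm]))
end

section
/- Let s and n be positive integers, m = ⌈n/s⌉, and let ε₁ > 0. Set ε′ = ln(1 + s·(e^{ε₁} − 1)). Let 𝒮 : {0,1}^n → PMF({0,1}^m) be the block-sampling map that outputs, independently for each of the m blocks of size s (the last block padded by 0), a uniformly sampled bit of that block. Let M : {0,1}^m → PMF(Ω) satisfy: for all u, v ∈ {0,1}^m at Hamming distance at most 1 and all events S ⊆ Ω, Pr[M(u) ∈ S] ≤ e^{ε′}·Pr[M(v) ∈ S]. Then the composed mechanism M ∘ 𝒮 satisfies ε₁-edge local differential privacy, i.e., for all a, â ∈ {0,1}^n at Hamming distance at most 1 and all events S ⊆ Ω, Pr[M(𝒮(a)) ∈ S] ≤ e^{ε₁}·Pr[M(𝒮(â)) ∈ S]. In particular, ln(1 + (e^{ε′} − 1)/s) = ε₁. -/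
open scoped ENNReal

/-- If the functions `p` and `q` on `κ × β`, with fibres `κ × {r}`, agree off the slice
`{j} × β`, and on the slice `p` exceeds no value of `q` in the same fibre by more than the factor
`1 + card κ * δ`, then the total mass of `p` exceeds that of `q` by at most the factor `1 + δ`. -/
theorem sum_prod_le_of_slice {κ β : Type*} [Fintype κ] [Fintype β]
    (p q : κ × β → ℝ) (j : κ) (δ : ℝ) (hδ : 0 ≤ δ)
    (heq : ∀ t r, t ≠ j → p (t, r) = q (t, r))
    (hle : ∀ t r, p (j, r) ≤ (1 + Fintype.card κ * δ) * q (t, r)) :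
    ∑ x, p x ≤ (1 + δ) * ∑ x, q x := by
  classical
  rw [Fintype.sum_prod_type_right, Fintype.sum_prod_type_right, Finset.mul_sum]
  refine Finset.sum_le_sum fun r _ => ?_
  have hcard : (0 : ℝ) < Fintype.card κ := by
    exact_mod_cast Fintype.card_pos_iff.mpr ⟨j⟩
  have hpt : ∀ t, p (j, r) - q (j, r) ≤ Fintype.card κ * δ * q (t, r) := by
    intro t
    have h₁ := hle t r
    have h₂ := hle j r
    have hk : 0 ≤ Fintype.card κ * δ := by positivity
    rcases le_total (q (t, r)) (q (j, r)) with h | h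
    · linarith
    · have := mul_le_mul_of_nonneg_left h hk
      linarith
  have havg : p (j, r) - q (j, r) ≤ δ * ∑ t, q (t, r) := by
    have h := Finset.sum_le_sum fun t (_ : t ∈ Finset.univ) => hpt t
    rw [Finset.sum_const, Finset.card_univ, nsmul_eq_mul, ← Finset.mul_sum, mul_assoc] at h
    exact le_of_mul_le_mul_left h hcard
  have hdiff : ∑ t, p (t, r) - ∑ t, q (t, r) = p (j, r) - q (j, r) := by
    rw [← Finset.sum_sub_distrib]
    exact Finset.sum_eq_single j (fun t _ ht => by simp [heq t r ht]) (by simp)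
  linarith

/-- The version of `sum_prod_le_of_slice` for a coordinate of a function space. -/
theorem sum_pi_le_of_slice {ι κ : Type*} [Fintype ι] [DecidableEq ι] [Fintype κ]
    (p q : (ι → κ) → ℝ) (i : ι) (j : κ) (δ : ℝ) (hδ : 0 ≤ δ)
    (heq : ∀ c, c i ≠ j → p c = q c)
    (hle : ∀ c c' : ι → κ, c i = j → (∀ k, k ≠ i → c k = c' k) →
      p c ≤ (1 + Fintype.card κ * δ) * q c') :
    ∑ c, p c ≤ (1 + δ) * ∑ c, q c := by
  let e := Equiv.funSplitAt i κ
  rw [← e.symm.sum_comp p, ← e.symm.sum_comp q]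
  refine sum_prod_le_of_slice (fun x => p (e.symm x)) (fun x => q (e.symm x)) j δ hδ ?_ ?_
  · intro t r ht
    exact heq _ (by simpa [e] using ht)
  · intro t r
    refine hle _ _ (by simp [e]) fun k hk => ?_
    simp [e, hk]

theorem hammingDist_le_one_of_forall_ne {ι : Type*} {β : ι → Type*} [Fintype ι]
    [∀ i, DecidableEq (β i)] {u v : ∀ i, β i} (i : ι) (h : ∀ k, k ≠ i → u k = v k) :
    hammingDist u v ≤ 1 := by
  classical
  refine (Finset.card_le_card (t := {i}) fun k hk => ?_).trans (by simp)
  by_contra hki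
  exact (Finset.mem_filter.mp hk).2 (h k (by simpa using hki))

theorem exists_forall_ne_of_hammingDist_le_one {ι : Type*} {β : ι → Type*} [Fintype ι]
    [∀ i, DecidableEq (β i)] [Nonempty ι] {u v : ∀ i, β i} (h : hammingDist u v ≤ 1) :
    ∃ i, ∀ k, k ≠ i → u k = v k := by
  obtain ⟨i, hi⟩ := Finset.card_le_one_iff_subset_singleton.mp h
  refine ⟨i, fun k hk => ?_⟩
  by_contra hne
  exact hk (by simpa using hi (Finset.mem_filter.mpr ⟨Finset.mem_univ k, hne⟩))

/-- The vector of bits read off by a choice `c` of one position in each block. -/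
def blockRead (n m s : ℕ) (a : Fin n → Bool) (c : Fin m → Fin s) : Fin m → Bool := fun i =>
  if h : i.val * s + (c i).val < n then a ⟨i.val * s + (c i).val, h⟩ else false

theorem PMF.toOuterMeasure_apply_ne_top {α : Type*} (p : PMF α) (S : Set α) :
    p.toOuterMeasure S ≠ ∞ := by
  rw [PMF.toOuterMeasure_apply]
  exact p.tsum_coe_indicator_ne_top S

theorem toReal_blockSample_bind {n m s : ℕ} (hs : 0 < s) {Ω : Type*}
    (M : (Fin m → Bool) → PMF Ω) (a : Fin n → Bool) (S : Set Ω) :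
    (((blockSample n m s hs a).bind M).toOuterMeasure S).toReal
      = (Fintype.card (Fin m → Fin s) : ℝ)⁻¹ *
        ∑ c, ((M (blockRead n m s a c)).toOuterMeasure S).toReal := by
  have : Nonempty (Fin s) := ⟨⟨0, hs⟩⟩
  have h : ((blockSample n m s hs a).bind M).toOuterMeasure S
      = (Fintype.card (Fin m → Fin s) : ℝ≥0∞)⁻¹ *
        ∑ c, (M (blockRead n m s a c)).toOuterMeasure S := by
    unfold blockSample
    rw [PMF.bind_map, PMF.toOuterMeasure_bind_apply, tsum_fintype, Finset.mul_sum]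
    refine Finset.sum_congr rfl fun c _ => ?_
    rw [PMF.uniformOfFintype_apply]
    rfl
  rw [h, ENNReal.toReal_mul, ENNReal.toReal_inv, ENNReal.toReal_natCast,
    ENNReal.toReal_sum fun c _ => PMF.toOuterMeasure_apply_ne_top _ S]

/-- the group randomized response step is `ε₁`-edge locally
differentially private.  If `M` satisfies the `ε′`-ratio bound with
`ε′ = ln(1 + s(e^{ε₁} − 1))`, then `M ∘ 𝒮` satisfies the `ε₁`-ratio bound;
in particular `ln(1 + (e^{ε′} − 1)/s) = ε₁`. -/
theorem group_randomized_response_privacy {n m s : ℕ} (hn : 0 < n) (hs : 0 < s)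
    (hm : m = (n + s - 1) / s) {Ω : Type*} (ε₁ ε' : ℝ) (hε₁ : 0 < ε₁)
    (hε' : ε' = Real.log (1 + s * (Real.exp ε₁ - 1)))
    (M : (Fin m → Bool) → PMF Ω)
    (hM : ∀ u v : Fin m → Bool, hammingDist u v ≤ 1 → ∀ S : Set Ω,
      (M u).toOuterMeasure S
        ≤ ENNReal.ofReal (Real.exp ε') * (M v).toOuterMeasure S) :
    (∀ a ahat : Fin n → Bool, hammingDist a ahat ≤ 1 → ∀ S : Set Ω,
      ((blockSample n m s hs a).bind M).toOuterMeasure S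
        ≤ ENNReal.ofReal (Real.exp ε₁)
          * ((blockSample n m s hs ahat).bind M).toOuterMeasure S) ∧
    Real.log (1 + (Real.exp ε' - 1) / s) = ε₁ := by
  have hs' : (0 : ℝ) < s := by exact_mod_cast hs
  have hδ : 0 < Real.exp ε₁ - 1 := by linarith [Real.add_one_lt_exp hε₁.ne']
  have hexp : Real.exp ε' = 1 + s * (Real.exp ε₁ - 1) := by
    rw [hε', Real.exp_log (by positivity)]
  refine ⟨fun a ahat hd S => ?_, ?_⟩
  · have hfin : ∀ (μ : PMF Ω), μ.toOuterMeasure S ≠ ∞ := fun μ =>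
      μ.toOuterMeasure_apply_ne_top S
    rw [← ENNReal.toReal_le_toReal (hfin _) (ENNReal.mul_ne_top ENNReal.ofReal_ne_top (hfin _)),
      ENNReal.toReal_mul, ENNReal.toReal_ofReal (Real.exp_pos _).le,
      toReal_blockSample_bind, toReal_blockSample_bind, mul_left_comm]
    refine mul_le_mul_of_nonneg_left ?_ (by positivity)
    have : Nonempty (Fin n) := ⟨⟨0, hn⟩⟩
    obtain ⟨k, hk⟩ := exists_forall_ne_of_hammingDist_le_one hd
    have hi : k.val / s < m := by
      rw [hm, ← Nat.succ_le_iff, Nat.succ_eq_add_one, ← Nat.add_div_right _ hs]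
      exact Nat.div_le_div_right (by have := k.isLt; omega)
    have hread : ∀ (i : Fin m) (t : Fin s) (h : i.val * s + t.val < n),
        (⟨i.val * s + t.val, h⟩ : Fin n) = k → i.val = k.val / s ∧ t.val = k.val % s := by
      rintro i t h rfl
      constructor
      · simp [Nat.add_comm (i.val * s), Nat.add_mul_div_right _ _ hs, Nat.div_eq_of_lt t.isLt]
      · simp [Nat.mod_eq_of_lt t.isLt]
    have key := sum_pi_le_of_slice
      (fun c => ((M (blockRead n m s a c)).toOuterMeasure S).toReal)
      (fun c => ((M (blockRead n m s ahat c)).toOuterMeasure S).toReal)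
      ⟨k.val / s, hi⟩ ⟨k.val % s, Nat.mod_lt _ hs⟩ (Real.exp ε₁ - 1) hδ.le ?_ ?_
    · simpa using key
    · intro c hc
      have : blockRead n m s a c = blockRead n m s ahat c := by
        funext i
        unfold blockRead
        split_ifs with h
        · refine hk _ fun hik => hc ?_
          obtain ⟨h₁, h₂⟩ := hread i (c i) h hik
          obtain rfl : i = ⟨k.val / s, hi⟩ := Fin.ext h₁
          exact Fin.ext h₂
        · rfl
      simp only [this]
    · intro c c' _ hcc'
      have hdist : hammingDist (blockRead n m s a c) (blockRead n m s ahat c') ≤ 1 := by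
        refine hammingDist_le_one_of_forall_ne ⟨k.val / s, hi⟩ fun i hne => ?_
        unfold blockRead
        simp only [← hcc' i hne]
        split_ifs with h
        · exact hk _ fun hik => hne (Fin.ext (hread i (c i) h hik).1)
        · rfl
      have := ENNReal.toReal_mono (ENNReal.mul_ne_top ENNReal.ofReal_ne_top (hfin _))
        (hM _ _ hdist S)
      rw [ENNReal.toReal_mul, ENNReal.toReal_ofReal (Real.exp_pos _).le, hexp] at this
      rwa [Fintype.card_fin]
  · rw [hexp, add_sub_cancel_left, mul_div_cancel_left₀ _ hs'.ne', add_sub_cancel, Real.log_exp]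
end

section
/- Fix an integer s ≥ 2, an integer m ≥ 2, a real d, and a real ε′ > 0. Define p_p = ((s−1)/s)·((d−1)/(m·s−1)) + 1/s, p_a = ((s−1)/s)·(d/(m·s−1)), p′_p = (e^{ε′}·p_p + (1 − p_p))/(1 + e^{ε′}), p′_a = (e^{ε′}·p_a + (1 − p_a))/(1 + e^{ε′}), ω = ((e^{ε′}+1)/(e^{ε′}−1))·((m·s−1)/(m−1)), and σ = ((s−1)/(m·s−s))·d + (1/(e^{ε′}−1))·((m·s−1)/(m−1)). Then ω·p′_p − σ = 1 and ω·p′_a − σ = 0. Equivalently, p′_p = (1 + σ)/ω and p′_a = σ/ω, so for a ∈ {0,1}, if X is a Bernoulli random variable with Pr[X = 1] = (a + σ)/ω, then E[ω·X − σ] = a (the debiased estimator is unbiased). -/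
/-- the debiased estimator ω·X − σ of the group randomized
response mechanism is unbiased. -/
theorem grr_unbiased (s m : ℕ) (hs : 2 ≤ s) (hm : 2 ≤ m)
    (d ε' pp pa pp' pa' ω σ : ℝ) (hε' : 0 < ε')
    (hpp : pp = (((s : ℝ) - 1) / s) * ((d - 1) / ((m : ℝ) * s - 1)) + 1 / s)
    (hpa : pa = (((s : ℝ) - 1) / s) * (d / ((m : ℝ) * s - 1)))
    (hpp' : pp' = (Real.exp ε' * pp + (1 - pp)) / (1 + Real.exp ε'))
    (hpa' : pa' = (Real.exp ε' * pa + (1 - pa)) / (1 + Real.exp ε'))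
    (hω : ω = ((Real.exp ε' + 1) / (Real.exp ε' - 1)) * (((m : ℝ) * s - 1) / ((m : ℝ) - 1)))
    (hσ : σ = (((s : ℝ) - 1) / ((m : ℝ) * s - s)) * d
        + (1 / (Real.exp ε' - 1)) * (((m : ℝ) * s - 1) / ((m : ℝ) - 1))) :
    ω * pp' - σ = 1 ∧ ω * pa' - σ = 0 ∧
    pp' = (1 + σ) / ω ∧ pa' = σ / ω ∧
    -- unbiasedness of the debiased estimator: for a bit `a` and a Bernoulli
    -- variable `X` with `Pr[X = 1] = (a + σ)/ω`, the expectation of `ω·X − σ`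
    -- equals `a`.
    ∀ a : ℝ, (a = 0 ∨ a = 1) →
      ((a + σ) / ω) * (ω * 1 - σ) + (1 - (a + σ) / ω) * (ω * 0 - σ) = a := by
  have hs' : (2 : ℝ) ≤ s := by exact_mod_cast hs
  have hm' : (2 : ℝ) ≤ m := by exact_mod_cast hm
  have he : 1 < Real.exp ε' := Real.one_lt_exp_iff.mpr hε'
  generalize Real.exp ε' = e at *
  generalize (s : ℝ) = s at *
  generalize (m : ℝ) = m at *
  have hs0 : s ≠ 0 := by positivity
  have hm1 : m - 1 ≠ 0 := by linarith
  have hms : m * s - 1 ≠ 0 := by nlinarith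
  have hsm : s * m - 1 ≠ 0 := by rwa [mul_comm s m]
  have he1 : e - 1 ≠ 0 := by linarith
  have he2 : 1 + e ≠ 0 := by linarith
  have he3 : e + 1 ≠ 0 := by linarith
  have hden : m * s - s = s * (m - 1) := by ring
  have hω0 : ω ≠ 0 := by
    rw [hω]
    exact mul_ne_zero (div_ne_zero he3 he1) (div_ne_zero hms hm1)
  have key (p : ℝ) : ω * ((e * p + (1 - p)) / (1 + e)) =
      (1 / (e - 1) + p) * ((m * s - 1) / (m - 1)) := by
    rw [hω]
    field_simp
    ring
  have present : ω * pp' - σ = 1 := by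
    rw [hpp', key, hσ, hpp, hden]
    field_simp
    ring
  have absent : ω * pa' - σ = 0 := by
    rw [hpa', key, hσ, hpa, hden]
    field_simp
    ring
  refine ⟨present, absent, ?_, ?_, fun a _ => ?_⟩
  · rw [eq_div_iff hω0]
    linarith
  · rw [eq_div_iff hω0]
    linarith
  · field_simp
    ring
end
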